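/- (Lemma, part 3) Assume (1/N)Σ_{k=1}^N ‖μ_A − μ_k‖₂² ≤ C_μ and (1/N)Σ_{k=1}^N ‖ν_A − ν_k‖₂² ≤ C_ν, where ‖·‖₂ is the spectral norm on matrices and Euclidean norm on vectors. Then with C = 2·max{C_μ, C_ν}, for every n ≥ 0 and every unit vector x ∈ ℝ^{n_x}: xᵀ Cov[d_n, d_n] x ≤ C η² (E[‖σ_n‖₂²] + 1). -/

import Mathlib

open Matrix MeasureTheory ProbabilityTheory
open scoped ENNReal

/-- The Euclidean (l²) norm of a vector in `ℝ^m`. -/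
noncomputable def evNorm {m : ℕ} (x : Fin m → ℝ) : ℝ :=
  ‖(EuclideanSpace.equiv (Fin m) ℝ).symm x‖

/-- The spectral (l²-operator) norm of a real matrix. -/
noncomputable def specNorm {a b : ℕ} (M : Matrix (Fin a) (Fin b) ℝ) : ℝ :=
  ‖LinearMap.toContinuousLinearMap (Matrix.toEuclideanLin M)‖

/-- The covariance matrix `Cov[X,Y] = E[(X − EX)(Y − EY)ᵀ]` of two random vectors,
with componentwise expectation. -/
noncomputable def vCov {Ω : Type*} [MeasurableSpace Ω] (P : MeasureTheory.Measure Ω) {m : ℕ}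
    (X Y : Ω → Fin m → ℝ) : Matrix (Fin m) (Fin m) ℝ :=
  Matrix.of fun i j =>
    ∫ ω, (X ω i - ∫ ω', X ω' i ∂P) * (Y ω j - ∫ ω', Y ω' j ∂P) ∂P

/-- Real functions of a random variable with values in a finite space are integrable. -/
theorem integrable_comp_of_finite {Ω T : Type*} [MeasurableSpace Ω] (P : Measure Ω)
    [IsFiniteMeasure P] [Finite T] [MeasurableSpace T] [MeasurableSingletonClass T]
    {X : Ω → T} (hX : Measurable X) (F : T → ℝ) : Integrable (fun ω => F (X ω)) P :=
  (Integrable.of_finite (μ := P.map X) (f := F)).comp_measurable hX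

theorem integral_comp_of_uniform {Ω : Type*} [MeasurableSpace Ω] (P : Measure Ω)
    [IsProbabilityMeasure P] {N : ℕ} {X : Ω → Fin N} (hX : Measurable X)
    (hunif : ∀ k, P {ω | X ω = k} = 1 / N) (F : Fin N → ℝ) :
    ∫ ω, F (X ω) ∂P = (N : ℝ)⁻¹ * ∑ k, F k := by
  rw [← integral_map (f := F) hX.aemeasurable
    (Measurable.of_discrete (f := F)).aestronglyMeasurable,
    integral_fintype Integrable.of_finite, Finset.mul_sum]
  refine Finset.sum_congr rfl fun k _ => ?_
  have hk : (P.map X).real {k} = (N : ℝ)⁻¹ := by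
    rw [map_measureReal_apply hX (measurableSet_singleton k), measureReal_def]
    have : X ⁻¹' {k} = {ω | X ω = k} := rfl
    rw [this, hunif]
    simp
  rw [hk, smul_eq_mul]

theorem evNorm_add_le {m : ℕ} (x y : Fin m → ℝ) : evNorm (x + y) ≤ evNorm x + evNorm y := by
  simp only [evNorm, map_add]
  exact norm_add_le _ _

theorem evNorm_nonneg {m : ℕ} (x : Fin m → ℝ) : 0 ≤ evNorm x := norm_nonneg _

theorem evNorm_smul {m : ℕ} (c : ℝ) (x : Fin m → ℝ) : evNorm (c • x) = |c| * evNorm x := by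
  simp only [evNorm, map_smul, norm_smul, Real.norm_eq_abs]

theorem evNorm_mulVec_le {a b : ℕ} (M : Matrix (Fin a) (Fin b) ℝ) (x : Fin b → ℝ) :
    evNorm (M *ᵥ x) ≤ specNorm M * evNorm x :=
  (LinearMap.toContinuousLinearMap (Matrix.toEuclideanLin M)).le_opNorm
    ((EuclideanSpace.equiv (Fin b) ℝ).symm x)

theorem sq_dotProduct_le {m : ℕ} (x y : Fin m → ℝ) :
    (x ⬝ᵥ y) ^ 2 ≤ evNorm x ^ 2 * evNorm y ^ 2 := by
  simp only [evNorm, EuclideanSpace.norm_sq_eq]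
  simpa [dotProduct] using Finset.sum_mul_sq_le_sq_mul_sq Finset.univ x y

/-- The quadratic form of a covariance matrix is the variance of the projection. -/
theorem dotProduct_vCov_mulVec {Ω : Type*} [MeasurableSpace Ω] (P : Measure Ω)
    [IsProbabilityMeasure P] {m : ℕ} {X : Ω → Fin m → ℝ} (hX : ∀ i, MemLp (fun ω => X ω i) 2 P)
    (x : Fin m → ℝ) : x ⬝ᵥ (vCov P X X *ᵥ x) = variance (fun ω => x ⬝ᵥ X ω) P := by
  have h : (fun ω => x ⬝ᵥ X ω) = ∑ i, fun ω => x i * X ω i := by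
    ext ω
    simp [dotProduct]
  rw [h, variance_sum fun i => (hX i).const_mul (x i)]
  simp only [dotProduct, mulVec, Finset.mul_sum]
  refine Finset.sum_congr rfl fun i _ => Finset.sum_congr rfl fun j _ => ?_
  rw [covariance_const_mul_left, covariance_const_mul_right]
  simp only [vCov, Matrix.of_apply, covariance]
  ring

/-- A recursively driven process is a function of its past innovations. -/
theorem exists_eq_comp_history {Ω E S : Type*} (γ : ℕ → Ω → E) (σs : ℕ → Ω → S) (σ0 : S)
    (f : E → S → S) (h0 : ∀ ω, σs 0 ω = σ0) (hrec : ∀ n ω, σs (n + 1) ω = f (γ n ω) (σs n ω))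
    (n : ℕ) : ∃ g : (Finset.range n → E) → S, ∀ ω, σs n ω = g fun i => γ i ω := by
  induction n with
  | zero => exact ⟨fun _ => σ0, h0⟩
  | succ n ih =>
    obtain ⟨g, hg⟩ := ih
    refine ⟨fun e => f (e ⟨n, Finset.self_mem_range_succ n⟩)
      (g fun i => e ⟨i, Finset.mem_range.2
        ((Finset.mem_range.1 i.2).trans n.lt_succ_self)⟩), fun ω => ?_⟩
    rw [hrec, hg]

theorem sq_dotProduct_noise_le {m : ℕ} (x : Fin m → ℝ) (hx : evNorm x = 1) (η : ℝ)
    (M : Matrix (Fin m) (Fin m) ℝ) (s v : Fin m → ℝ) :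
    (x ⬝ᵥ (η • (M *ᵥ s + v))) ^ 2
      ≤ 2 * η ^ 2 * (specNorm M ^ 2 * evNorm s ^ 2 + evNorm v ^ 2) := by
  have h1 := sq_dotProduct_le x (η • (M *ᵥ s + v))
  rw [hx, evNorm_smul, mul_pow, sq_abs, one_pow, one_mul] at h1
  have h2 : evNorm (M *ᵥ s + v) ≤ specNorm M * evNorm s + evNorm v :=
    (evNorm_add_le _ _).trans (by gcongr; exact evNorm_mulVec_le M s)
  calc (x ⬝ᵥ (η • (M *ᵥ s + v))) ^ 2 ≤ η ^ 2 * evNorm (M *ᵥ s + v) ^ 2 := h1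
    _ ≤ η ^ 2 * (specNorm M * evNorm s + evNorm v) ^ 2 := by
        gcongr
        exact evNorm_nonneg _
    _ ≤ η ^ 2 * (2 * ((specNorm M * evNorm s) ^ 2 + evNorm v ^ 2)) := by
        gcongr
        exact add_sq_le
    _ = _ := by ring

/-- Lemma, part 3: Assuming `(1/N)Σ_k ‖μ_A − μ_k‖₂² ≤ C_μ` and
`(1/N)Σ_k ‖ν_A − ν_k‖₂² ≤ C_ν`, with `C = 2·max{C_μ, C_ν}`, for every `n` and every unit
vector `x`: `xᵀ Cov[d_n, d_n] x ≤ C η² (E[‖σ_n‖₂²] + 1)`. -/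
theorem sgd_noise_covariance_bound
    (N nx np : ℕ) (hN : 0 < N)
    (A : Fin N → Matrix (Fin np) (Fin nx) ℝ) (b : Fin N → Fin np → ℝ)
    (μ : Fin N → Matrix (Fin nx) (Fin nx) ℝ) (hμ : ∀ k, μ k = (A k)ᵀ * A k)
    (ν : Fin N → Fin nx → ℝ) (hν : ∀ k, ν k = -((A k)ᵀ *ᵥ b k))
    (μA : Matrix (Fin nx) (Fin nx) ℝ) (hμA : μA = (N : ℝ)⁻¹ • ∑ k, μ k)
    (νA : Fin nx → ℝ) (hνA : νA = (N : ℝ)⁻¹ • ∑ k, ν k)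
    (α η : ℝ) (hα : 0 < α) (hη : 0 < η)
    {Ω : Type*} [MeasurableSpace Ω] (P : Measure Ω) [IsProbabilityMeasure P]
    (γ : ℕ → Ω → Fin N) (hγmeas : ∀ n, Measurable (γ n))
    (hγindep : iIndepFun γ P)
    (hγunif : ∀ n k, P {ω | γ n ω = k} = 1 / N)
    (σ0 : Fin nx → ℝ) (σs : ℕ → Ω → Fin nx → ℝ)
    (hσ0 : ∀ ω, σs 0 ω = σ0)
    (hrec : ∀ n ω, σs (n + 1) ω
      = σs n ω - η • ((μ (γ n ω) + α • (1 : Matrix (Fin nx) (Fin nx) ℝ)) *ᵥ σs n ω + ν (γ n ω)))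
    (hL2 : ∀ n, MemLp (σs n) 2 P)
    (d : ℕ → Ω → Fin nx → ℝ)
    (hd : ∀ n ω, d n ω = η • ((μA - μ (γ n ω)) *ᵥ σs n ω + νA - ν (γ n ω)))
    (Cμ Cν : ℝ)
    (hCμ : (N : ℝ)⁻¹ * ∑ k, specNorm (μA - μ k) ^ 2 ≤ Cμ)
    (hCν : (N : ℝ)⁻¹ * ∑ k, evNorm (νA - ν k) ^ 2 ≤ Cν)
    : ∀ (n : ℕ) (x : Fin nx → ℝ), evNorm x = 1 →
      x ⬝ᵥ (vCov P (d n) (d n) *ᵥ x)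
        ≤ 2 * max Cμ Cν * η ^ 2 * ((∫ ω, evNorm (σs n ω) ^ 2 ∂P) + 1) := by
  intro n x hx
  obtain ⟨g, hg⟩ := exists_eq_comp_history γ σs σ0
    (fun k s => s - η • ((μ k + α • (1 : Matrix (Fin nx) (Fin nx) ℝ)) *ᵥ s + ν k)) hσ0 hrec n
  obtain ⟨H, hH⟩ : ∃ H : Ω → (Finset.range n → Fin N), H = fun ω (i : Finset.range n) => γ i ω :=
    ⟨_, rfl⟩
  have hHmeas : Measurable H := hH ▸ measurable_pi_lambda _ fun i => hγmeas i
  replace hg (ω : Ω) : σs n ω = g (H ω) := by rw [hg, hH]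
  have hindep : IndepFun (γ n) H P := by
    have h := hγindep.indepFun_finset {n} (Finset.range n) (by simp) hγmeas
    rw [hH]
    exact h.comp (φ := fun e : ({n} : Finset ℕ) → Fin N => e ⟨n, Finset.mem_singleton_self n⟩)
      (ψ := id) (measurable_pi_apply _) measurable_id
  have hint (F : Fin N × (Finset.range n → Fin N) → ℝ) :
      Integrable (fun ω => F (γ n ω, H ω)) P :=
    integrable_comp_of_finite P ((hγmeas n).prodMk hHmeas) F
  have hd' (ω : Ω) : d n ω = η • ((μA - μ (γ n ω)) *ᵥ g (H ω) + (νA - ν (γ n ω))) := by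
    rw [hd, hg, add_sub_assoc]
  have hdmem (i : Fin nx) : MemLp (fun ω => d n ω i) 2 P := by
    simp only [hd']
    refine (memLp_two_iff_integrable_sq (hint fun p =>
      (η • ((μA - μ p.1) *ᵥ g p.2 + (νA - ν p.1))) i).aestronglyMeasurable).2 ?_
    exact hint fun p => (η • ((μA - μ p.1) *ᵥ g p.2 + (νA - ν p.1))) i ^ 2
  have hprod : ∫ ω, specNorm (μA - μ (γ n ω)) ^ 2 * evNorm (g (H ω)) ^ 2 ∂P
      = (∫ ω, specNorm (μA - μ (γ n ω)) ^ 2 ∂P) * ∫ ω, evNorm (g (H ω)) ^ 2 ∂P :=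
    (hindep.comp (φ := fun k => specNorm (μA - μ k) ^ 2) (ψ := fun e => evNorm (g e) ^ 2)
      .of_discrete .of_discrete).integral_fun_mul_eq_mul_integral
      (hint fun p => specNorm (μA - μ p.1) ^ 2).aestronglyMeasurable
      (hint fun p => evNorm (g p.2) ^ 2).aestronglyMeasurable
  have hi₁ : Integrable (fun ω => specNorm (μA - μ (γ n ω)) ^ 2 * evNorm (g (H ω)) ^ 2) P :=
    hint fun p => specNorm (μA - μ p.1) ^ 2 * evNorm (g p.2) ^ 2
  have hi₂ : Integrable (fun ω => evNorm (νA - ν (γ n ω)) ^ 2) P :=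
    hint fun p => evNorm (νA - ν p.1) ^ 2
  have hs : 0 ≤ ∫ ω, evNorm (g (H ω)) ^ 2 ∂P := integral_nonneg fun ω => sq_nonneg _
  rw [dotProduct_vCov_mulVec P hdmem]
  simp only [hg]
  calc variance (fun ω => x ⬝ᵥ d n ω) P ≤ ∫ ω, (x ⬝ᵥ d n ω) ^ 2 ∂P := by
        refine variance_le_expectation_sq ?_
        simp only [hd']
        exact (hint fun p => x ⬝ᵥ (η • ((μA - μ p.1) *ᵥ g p.2 + (νA - ν p.1)))).aestronglyMeasurable
    _ ≤ ∫ ω, 2 * η ^ 2 * (specNorm (μA - μ (γ n ω)) ^ 2 * evNorm (g (H ω)) ^ 2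
          + evNorm (νA - ν (γ n ω)) ^ 2) ∂P := by
        simp only [hd']
        exact integral_mono
          (hint fun p => (x ⬝ᵥ (η • ((μA - μ p.1) *ᵥ g p.2 + (νA - ν p.1)))) ^ 2)
          ((hi₁.add hi₂).const_mul (2 * η ^ 2))
          fun ω => sq_dotProduct_noise_le x hx η _ _ _
    _ = 2 * η ^ 2 * ((N : ℝ)⁻¹ * (∑ k, specNorm (μA - μ k) ^ 2) * ∫ ω, evNorm (g (H ω)) ^ 2 ∂P
          + (N : ℝ)⁻¹ * ∑ k, evNorm (νA - ν k) ^ 2) := by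
        rw [integral_const_mul, integral_add hi₁ hi₂, hprod,
          integral_comp_of_uniform P (hγmeas n) (hγunif n) fun k => specNorm (μA - μ k) ^ 2,
          integral_comp_of_uniform P (hγmeas n) (hγunif n) fun k => evNorm (νA - ν k) ^ 2]
    _ ≤ 2 * η ^ 2 * (max Cμ Cν * ∫ ω, evNorm (g (H ω)) ^ 2 ∂P + max Cμ Cν) := by
        refine mul_le_mul_of_nonneg_left (add_le_add (mul_le_mul_of_nonneg_right ?_ hs) ?_)
          (by positivity)
        · exact hCμ.trans (le_max_left _ _)
        · exact hCν.trans (le_max_right _ _)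
    _ = 2 * max Cμ Cν * η ^ 2 * ((∫ ω, evNorm (g (H ω)) ^ 2 ∂P) + 1) := by ring
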